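/- Let p, q, r be distinct primes. The complexity of the cyclic group C_{pqr} of order pqr equals 7, and the width of C_{pqr} equals 3. -/

import Mathlib

/-- A transfer system for a finite group `G`. -/
def IsTransferSystem {G : Type*} [Group G] (T : Set (Subgroup G × Subgroup G)) : Prop :=
  (∀ p ∈ T, p.1 ≤ p.2) ∧
  (∀ H : Subgroup G, (H, H) ∈ T) ∧
  (∀ H K L : Subgroup G, (H, K) ∈ T → (K, L) ∈ T → (H, L) ∈ T) ∧
  (∀ H K : Subgroup G, (H, K) ∈ T → ∀ g : G,
    (Subgroup.map (MulAut.conj g).toMonoidHom H, Subgroup.map (MulAut.conj g).toMonoidHom K) ∈ T) ∧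
  (∀ H K L : Subgroup G, (H, K) ∈ T → L ≤ K → (H ⊓ L, L) ∈ T)

/-- The transfer system generated by a set `S` of pairs of subgroups. -/
def genTS {G : Type*} [Group G] (S : Set (Subgroup G × Subgroup G)) :
    Set (Subgroup G × Subgroup G) :=
  ⋂₀ {T | IsTransferSystem T ∧ S ⊆ T}

/-- The minimal cardinality of a set of pairs `(H, K)` with `H < K` generating
the transfer system `T`. -/
noncomputable def minGenSize {G : Type*} [Group G] (T : Set (Subgroup G × Subgroup G)) : ℕ :=
  sInf {n : ℕ | ∃ S : Set (Subgroup G × Subgroup G), (∀ p ∈ S, p.1 < p.2) ∧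
    genTS S = T ∧ S.ncard = n}

/-- The width of `G`: the minimal number of generators of the complete transfer system. -/
noncomputable def width (G : Type*) [Group G] : ℕ :=
  minGenSize {p : Subgroup G × Subgroup G | p.1 ≤ p.2}

/-- The complexity of `G`: the maximum over all transfer systems `T` for `G` of the
minimal number of generators of `T`. -/
noncomputable def complexity (G : Type*) [Group G] : ℕ :=
  sSup {n : ℕ | ∃ T : Set (Subgroup G × Subgroup G), IsTransferSystem T ∧ minGenSize T = n}

open Finset

/-- The order-theoretic part of the axioms of a transfer system, for a relation on a lattice. -/
structure IsTransferRelation {L : Type*} [Lattice L] (t : L → L → Prop) : Prop where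
  le : ∀ {a b}, t a b → a ≤ b
  refl : ∀ a, t a a
  trans : ∀ {a b c}, t a b → t b c → t a c
  restrict : ∀ {a b c}, t a b → c ≤ b → t (a ⊓ c) c

section General

variable {G : Type*}

theorem isTransferSystem_iff [CommGroup G] {T : Set (Subgroup G × Subgroup G)} :
    IsTransferSystem T ↔ IsTransferRelation fun H K => (H, K) ∈ T := by
  have hconj : ∀ (g : G) (H : Subgroup G), H.map (MulAut.conj g).toMonoidHom = H := by
    intro g H
    ext x
    simp [Subgroup.mem_map]
  constructor
  · rintro ⟨h₁, h₂, h₃, -, h₅⟩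
    exact ⟨fun h => h₁ _ h, h₂, fun h h' => h₃ _ _ _ h h', fun h h' => h₅ _ _ _ h h'⟩
  · rintro ⟨h₁, h₂, h₃, h₅⟩
    refine ⟨fun _ h => h₁ h, h₂, fun _ _ _ h h' => h₃ h h', fun H K h g => ?_,
      fun _ _ _ h h' => h₅ h h'⟩
    rwa [hconj, hconj]

theorem IsTransferRelation.comp_orderIso {L M : Type*} [Lattice L] [Lattice M]
    {t : M → M → Prop} (ht : IsTransferRelation t) (e : L ≃o M) :
    IsTransferRelation fun a b => t (e a) (e b) where
  le h := e.le_iff_le.1 (ht.le h)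
  refl a := ht.refl _
  trans h h' := ht.trans h h'
  restrict h h' := by
    simpa only [map_inf] using ht.restrict h (e.monotone h')

theorem genTS_eq_of_forall [Group G] {S T : Set (Subgroup G × Subgroup G)}
    (hT : IsTransferSystem T) (hST : S ⊆ T)
    (h : ∀ U, IsTransferSystem U → S ⊆ U → T ⊆ U) : genTS S = T :=
  Set.Subset.antisymm (Set.sInter_subset_of_mem ⟨hT, hST⟩)
    (Set.subset_sInter fun U hU => h U hU.1 hU.2)

theorem minGenSize_le_ncard [Group G] {S T : Set (Subgroup G × Subgroup G)}
    (hS : ∀ p ∈ S, p.1 < p.2) (h : genTS S = T) : minGenSize T ≤ S.ncard :=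
  Nat.sInf_le ⟨S, hS, h, rfl⟩

/-- A pair of a transfer system that is neither a composite of two other pairs nor a restriction
of another pair belongs to every generating set. -/
theorem mem_of_genTS_eq [CommGroup G] {S T : Set (Subgroup G × Subgroup G)} {H K : Subgroup G}
    (hT : IsTransferSystem T) (hS : genTS S = T) (hHK : H ≠ K) (hmem : (H, K) ∈ T)
    (hcomp : ∀ L, (H, L) ∈ T → (L, K) ∈ T → L = H ∨ L = K)
    (hres : ∀ A B, (A, B) ∈ T → K < B → A ⊓ K ≠ H) : (H, K) ∈ S := by
  by_contra hnot
  have hST : S ⊆ T := hS ▸ Set.subset_sInter fun _ hU => hU.2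
  have hT' := isTransferSystem_iff.1 hT
  have hU : IsTransferSystem (T \ {(H, K)}) := by
    refine isTransferSystem_iff.2 ⟨fun h => hT'.le h.1, fun A => ⟨hT'.refl A, ?_⟩, ?_, ?_⟩
    · simp only [Set.mem_singleton_iff, Prod.mk.injEq, not_and]
      rintro rfl
      exact hHK
    · rintro A B C ⟨hAB, hAB'⟩ ⟨hBC, hBC'⟩
      refine ⟨hT'.trans hAB hBC, ?_⟩
      simp only [Set.mem_singleton_iff, Prod.mk.injEq, not_and] at hAB' hBC' ⊢
      rintro rfl rfl
      rcases hcomp B hAB hBC with rfl | rfl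
      · exact hBC' rfl rfl
      · exact hAB' rfl rfl
    · rintro A B C ⟨hAB, hAB'⟩ hCB
      refine ⟨hT'.restrict hAB hCB, ?_⟩
      simp only [Set.mem_singleton_iff, Prod.mk.injEq, not_and] at hAB' ⊢
      rintro hAC rfl
      rcases hCB.eq_or_lt with rfl | hlt
      · exact hAB' (by rwa [inf_eq_left.2 (hT'.le hAB)] at hAC) rfl
      · exact hres A B hAB hlt hAC
  have : (H, K) ∈ T \ {(H, K)} :=
    (hS ▸ hmem : (H, K) ∈ genTS S) _ ⟨hU, fun x hx => ⟨hST hx, by rintro rfl; exact hnot hx⟩⟩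
  exact this.2 rfl

theorem card_le_minGenSize [Group G] [Finite G] {T : Set (Subgroup G × Subgroup G)}
    {S₀ : Set (Subgroup G × Subgroup G)} (hS₀ : ∀ p ∈ S₀, p.1 < p.2) (hgen : genTS S₀ = T)
    {E : Set (Subgroup G × Subgroup G)} (hE : ∀ S, genTS S = T → E ⊆ S) :
    E.ncard ≤ minGenSize T := by
  refine le_csInf ⟨_, S₀, hS₀, hgen, rfl⟩ ?_
  rintro n ⟨S, -, hS, rfl⟩
  exact Set.ncard_le_ncard (hE S hS)

theorem isTransferSystem_le [CommGroup G] :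
    IsTransferSystem {p : Subgroup G × Subgroup G | p.1 ≤ p.2} :=
  isTransferSystem_iff.2 ⟨id, fun H => le_refl H, fun h h' => le_trans (α := Subgroup G) h h',
    fun _ _ => Set.mem_ofPred.2 inf_le_right⟩

/-- All inclusions of subgroups except those of nontrivial proper subgroups into the whole
group. -/
def nearlyCompleteTS (G : Type*) [Group G] : Set (Subgroup G × Subgroup G) :=
  {p | p.1 ≤ p.2 ∧ (p.2 = ⊤ → p.1 = ⊥ ∨ p.1 = ⊤)}

theorem isTransferSystem_nearlyCompleteTS [CommGroup G] :
    IsTransferSystem (nearlyCompleteTS G) := by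
  refine isTransferSystem_iff.2 ⟨fun h => h.1, fun H => ⟨le_rfl, Or.inr⟩, ?_, ?_⟩
  · rintro A B C ⟨hAB, hB⟩ ⟨hBC, hC⟩
    refine ⟨hAB.trans hBC, fun h => ?_⟩
    rcases hC h with rfl | rfl
    · exact Or.inl (le_bot_iff.1 hAB)
    · exact hB rfl
  · rintro A B C ⟨hAB, hB⟩ hCB
    refine ⟨inf_le_right, ?_⟩
    rintro rfl
    simpa using hB (top_le_iff.1 hCB)

end General

section SquarefreeCyclic

theorem exists_prod_eq_of_dvd_prod {ι : Type*} [Fintype ι] {π : ι → ℕ}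
    (hπ : ∀ i, (π i).Prime) (hinj : Function.Injective π) {d : ℕ} (hd : d ∣ ∏ i, π i) :
    ∃ s : Finset ι, d = ∏ i ∈ s, π i := by
  classical
  have hsq : Squarefree (∏ i, π i) :=
    Finset.squarefree_prod_of_pairwise_isCoprime
      (fun i _ j _ hij => Nat.coprime_iff_isRelPrime.1 <|
        (Nat.coprime_primes (hπ i) (hπ j)).2 (hinj.ne hij))
      (fun i _ => (hπ i).prime.squarefree)
  have hd0 : d ≠ 0 := ne_zero_of_dvd_ne_zero hsq.ne_zero hd
  refine ⟨univ.filter fun i => π i ∣ d, ?_⟩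
  rw [← Finset.prod_image (f := fun x => x) hinj.injOn]
  conv_lhs => rw [← Nat.prod_primeFactors_of_squarefree (hsq.squarefree_of_dvd hd)]
  congr 1
  ext x
  simp only [Nat.mem_primeFactors, mem_image, mem_filter, mem_univ, true_and]
  constructor
  · rintro ⟨hx, hxd, -⟩
    obtain ⟨i, -, hi⟩ := (hx.prime.dvd_finsetProd_iff _).1 (hxd.trans hd)
    obtain rfl := (Nat.prime_dvd_prime_iff_eq hx (hπ i)).1 hi
    exact ⟨i, hxd, rfl⟩
  · rintro ⟨i, hi, rfl⟩
    exact ⟨hπ i, hi, hd0⟩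

/-- The subgroup lattice of a cyclic group of squarefree order is a Boolean lattice. -/
theorem exists_orderIso_subgroup {G : Type*} [CommGroup G] [IsCyclic G] [Finite G]
    {ι : Type*} [Fintype ι] {π : ι → ℕ} (hπ : ∀ i, (π i).Prime) (hinj : Function.Injective π)
    (hcard : Nat.card G = ∏ i, π i) : Nonempty (Finset ι ≃o Subgroup G) := by
  classical
  let f : Finset ι → Subgroup G := fun s => (powMonoidHom (∏ i ∈ s, π i) : G →* G).ker
  have hf : ∀ s, Nat.card (f s) = ∏ i ∈ s, π i := by
    intro s
    rw [IsCyclic.card_powMonoidHom_ker, hcard]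
    exact Nat.gcd_eq_right (Finset.prod_dvd_prod_of_subset _ _ _ (subset_univ s))
  have hle : ∀ {s t}, f s ≤ f t ↔ s ≤ t := by
    intro s t
    constructor
    · intro h i hi
      have h' := Subgroup.card_dvd_of_le h
      rw [hf, hf] at h'
      obtain ⟨j, hj, hij⟩ := ((hπ i).prime.dvd_finsetProd_iff _).1
        ((Finset.dvd_prod_of_mem π hi).trans h')
      rwa [hinj ((Nat.prime_dvd_prime_iff_eq (hπ i) (hπ j)).1 hij)]
    · intro h x hx
      obtain ⟨k, hk⟩ := Finset.prod_dvd_prod_of_subset _ _ π h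
      simp only [f, MonoidHom.mem_ker, powMonoidHom_apply] at hx ⊢
      rw [hk, pow_mul, hx, one_pow]
  have hsurj : Function.Surjective f := by
    intro H
    obtain ⟨s, hs⟩ := exists_prod_eq_of_dvd_prod hπ hinj (hcard ▸ Subgroup.card_subgroup_dvd_card H)
    refine ⟨s, (Subgroup.eq_of_le_of_card_ge (fun x hx => ?_) ?_).symm⟩
    · simp only [f, MonoidHom.mem_ker, powMonoidHom_apply, ← hs]
      exact congrArg Subtype.val (pow_card_eq_one' (x := (⟨x, hx⟩ : H)))
    · rw [hf, hs]
  exact ⟨RelIso.ofSurjective (OrderEmbedding.ofMapLEIff f fun _ _ => hle) hsurj⟩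

end SquarefreeCyclic

section BooleanLattice

/-- The second element of the ordered pair of distinct elements of `Fin 3` coded by `(i, c)`. -/
def pairSnd (i : Fin 3) (c : Bool) : Fin 3 := if c then i + 1 else i + 2

/-- A bijection from `Fin 3 × Bool` to the nonempty proper subsets of `Fin 3`; the subset attached
to `(i, c)` meets `{i, pairSnd i c}` in `{i}`. -/
def properSubset (i : Fin 3) (c : Bool) : Finset (Fin 3) := if c then {i} else {i, i + 1}

open Classical in
/-- Seven pairs such that the ones among them that belong to a transfer relation `t` generate
`t`. -/
noncomputable def generatorPair (t : Finset (Fin 3) → Finset (Fin 3) → Prop) :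
    Option (Fin 3 × Bool) → Finset (Fin 3) × Finset (Fin 3)
  | none => (⊥, ⊤)
  | some (i, c) =>
    if t (properSubset i c) ⊤ then (properSubset i c, ⊤)
    else if t {i} {i, pairSnd i c} then ({i}, {i, pairSnd i c})
    else if t ⊥ {i, pairSnd i c} then (⊥, {i, pairSnd i c})
    else (⊥, {pairSnd i c})

theorem generatorPair_lt (t : Finset (Fin 3) → Finset (Fin 3) → Prop)
    (x : Option (Fin 3 × Bool)) : (generatorPair t x).1 < (generatorPair t x).2 := by
  rcases x with _ | ⟨i, c⟩
  · simp [generatorPair]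
  · have h : properSubset i c < ⊤ ∧ ({i} : Finset (Fin 3)) < {i, pairSnd i c} := by
      revert i c; decide
    simp only [generatorPair]
    split_ifs
    · exact h.1
    · exact h.2
    · exact bot_lt_iff_ne_bot.2 (by simp)
    · exact bot_lt_iff_ne_bot.2 (by simp)

theorem IsTransferRelation.le_of_generatorPair {t u : Finset (Fin 3) → Finset (Fin 3) → Prop}
    (ht : IsTransferRelation t) (hu : IsTransferRelation u)
    (h : ∀ x, t (generatorPair t x).1 (generatorPair t x).2 →
      u (generatorPair t x).1 (generatorPair t x).2) {a b : Finset (Fin 3)} (hab : t a b) :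
    u a b := by
  have hpair : ∀ i j : Fin 3, i ≠ j → ∃ c, j = pairSnd i c := by decide
  have hsub : ∀ s : Finset (Fin 3), s ≠ ⊥ → s ≠ ⊤ → ∃ i c, s = properSubset i c := by decide
  have hmeet : ∀ i c, properSubset i c ⊓ {i, pairSnd i c} = {i} := by decide
  have hdisj : ∀ i j : Fin 3, i ≠ j → ({i} : Finset (Fin 3)) ⊓ {j} = ⊥ := by decide
  have hfst : ∀ i j : Fin 3, ({i} : Finset (Fin 3)) ≤ {i, j} := by decide
  have hsnd : ∀ i j : Fin 3, ({j} : Finset (Fin 3)) ≤ {i, j} := by decide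
  have hsnd_ne : ∀ i c, pairSnd i c ≠ i := by decide
  have htop : ∀ s, t s ⊤ → u s ⊤ := by
    intro s hs
    by_cases h₀ : s = ⊥
    · subst h₀
      exact h none hs
    by_cases h₁ : s = ⊤
    · subst h₁
      exact hu.refl _
    obtain ⟨i, c, rfl⟩ := hsub s h₀ h₁
    simpa only [generatorPair, hs, if_true, if_false, true_imp_iff] using h (some (i, c))
  have hedge : ∀ i c, t {i} {i, pairSnd i c} → u {i} {i, pairSnd i c} := by
    intro i c hic
    by_cases hs : t (properSubset i c) ⊤
    · simpa only [hmeet] using hu.restrict (htop _ hs) (le_top (a := {i, pairSnd i c}))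
    · simpa only [generatorPair, hs, hic, if_true, if_false, true_imp_iff] using h (some (i, c))
  have hnot : ∀ i c, ¬ t {i} {i, pairSnd i c} → ¬ t (properSubset i c) ⊤ := by
    intro i c hic hs
    exact hic (by simpa only [hmeet] using ht.restrict hs (le_top (a := {i, pairSnd i c})))
  have hbot₂ : ∀ i c, t ⊥ {i, pairSnd i c} → u ⊥ {i, pairSnd i c} := by
    intro i c hic
    by_cases h₁ : t {i} {i, pairSnd i c}
    · have hne : pairSnd i c ≠ i := hsnd_ne i c
      obtain ⟨c', hc'⟩ := hpair (pairSnd i c) i hne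
      have hcomm : ({i, pairSnd i c} : Finset (Fin 3)) =
          {pairSnd i c, pairSnd (pairSnd i c) c'} := by
        rw [← hc', Finset.pair_comm]
      by_cases h₂ : t {pairSnd i c} {i, pairSnd i c}
      · have h₃ := hu.restrict (hedge i c h₁) (hsnd i (pairSnd i c))
        rw [hdisj _ _ hne.symm] at h₃
        rw [hcomm] at h₂ ⊢
        exact hu.trans h₃ (hedge _ _ h₂)
      · rw [hcomm] at h₂ hic ⊢
        simpa only [generatorPair, hnot _ _ h₂, h₂, hic, if_true, if_false, true_imp_iff]
          using h (some (pairSnd i c, c'))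
    · simpa only [generatorPair, hnot _ _ h₁, h₁, hic, if_true, if_false, true_imp_iff] using h (some (i, c))
  have hbot₁ : ∀ j, t ⊥ {j} → u ⊥ {j} := by
    intro j hj
    obtain ⟨i, hij⟩ : ∃ i, i ≠ j := exists_ne j
    obtain ⟨c, rfl⟩ := hpair i j hij
    by_cases h₁ : t {i} {i, pairSnd i c}
    · have h₃ := hu.restrict (hedge i c h₁) (hsnd i (pairSnd i c))
      rwa [hdisj _ _ hij] at h₃
    by_cases h₂ : t ⊥ {i, pairSnd i c}
    · simpa only [bot_inf_eq] using hu.restrict (hbot₂ i c h₂) (hsnd i (pairSnd i c))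
    · simpa only [generatorPair, hnot _ _ h₁, h₁, h₂, hj, if_true, if_false, true_imp_iff] using h (some (i, c))
  have hcases : ∀ a b : Finset (Fin 3), a ≤ b → a = b ∨ b = ⊤ ∨
      (∃ i c, a = {i} ∧ b = {i, pairSnd i c}) ∨ (∃ i c, a = ⊥ ∧ b = {i, pairSnd i c}) ∨
      ∃ j, a = ⊥ ∧ b = {j} := by decide
  rcases hcases a b (ht.le hab) with rfl | rfl | ⟨i, c, rfl, rfl⟩ | ⟨i, c, rfl, rfl⟩ | ⟨j, rfl, rfl⟩
  · exact hu.refl _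
  · exact htop _ hab
  · exact hedge _ _ hab
  · exact hbot₂ _ _ hab
  · exact hbot₁ _ hab

end BooleanLattice

section BooleanSubgroupLattice

variable {G : Type*} [CommGroup G]

theorem exists_generators_ncard_le_seven (e : Finset (Fin 3) ≃o Subgroup G)
    {T : Set (Subgroup G × Subgroup G)} (hT : IsTransferSystem T) :
    ∃ S : Set (Subgroup G × Subgroup G), (∀ p ∈ S, p.1 < p.2) ∧ genTS S = T ∧ S.ncard ≤ 7 := by
  let t : Finset (Fin 3) → Finset (Fin 3) → Prop := fun a b => (e a, e b) ∈ T
  let g : Option (Fin 3 × Bool) → Subgroup G × Subgroup G := fun x =>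
    (e (generatorPair t x).1, e (generatorPair t x).2)
  refine ⟨Set.range g ∩ T, ?_, genTS_eq_of_forall hT Set.inter_subset_right ?_, ?_⟩
  · rintro _ ⟨⟨x, rfl⟩, -⟩
    exact e.lt_iff_lt.2 (generatorPair_lt t x)
  · rintro U hU hSU ⟨H, K⟩ hHK
    have := ((isTransferSystem_iff.1 hT).comp_orderIso e).le_of_generatorPair
      ((isTransferSystem_iff.1 hU).comp_orderIso e)
      (fun x hx => hSU ⟨⟨x, rfl⟩, hx⟩) (a := e.symm H) (b := e.symm K) (by simpa using hHK)
    simpa using this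
  · calc (Set.range g ∩ T).ncard ≤ (Set.range g).ncard :=
          Set.ncard_le_ncard Set.inter_subset_left (Set.finite_range g)
      _ = (g '' Set.univ).ncard := by rw [Set.image_univ]
      _ ≤ (Set.univ : Set (Option (Fin 3 × Bool))).ncard := Set.ncard_image_le
      _ = 7 := by rw [Set.ncard_univ, Nat.card_eq_fintype_card]; rfl

theorem minGenSize_le_seven (e : Finset (Fin 3) ≃o Subgroup G)
    {T : Set (Subgroup G × Subgroup G)} (hT : IsTransferSystem T) : minGenSize T ≤ 7 := by
  obtain ⟨S, hS, hgen, hcard⟩ := exists_generators_ncard_le_seven e hT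
  exact (minGenSize_le_ncard hS hgen).trans hcard

theorem seven_le_minGenSize_nearlyCompleteTS [Finite G] (e : Finset (Fin 3) ≃o Subgroup G) :
    7 ≤ minGenSize (nearlyCompleteTS G) := by
  have hT : IsTransferSystem (nearlyCompleteTS G) := isTransferSystem_nearlyCompleteTS
  obtain ⟨S₀, hS₀, hgen, -⟩ := exists_generators_ncard_le_seven e hT
  let F : Option (Fin 3 × Bool) → Finset (Fin 3) × Finset (Fin 3) :=
    fun x => x.elim (⊥, ⊤) fun y => ({y.1}, {y.1, pairSnd y.1 y.2})
  have hF : Function.Injective F := by decide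
  have hinj : Function.Injective fun x => Prod.map e e (F x) :=
    (e.injective.prodMap e.injective).comp hF
  have hcard : (Set.range fun x => Prod.map e e (F x)).ncard = 7 := by
    rw [← Set.image_univ, Set.ncard_image_of_injective _ hinj, Set.ncard_univ,
      Nat.card_eq_fintype_card]
    rfl
  rw [← hcard]
  refine card_le_minGenSize hS₀ hgen ?_
  rintro S hS _ ⟨_ | ⟨i, c⟩, rfl⟩
  · have hne : (⊥ : Subgroup G) ≠ ⊤ := by
      rw [← e.map_bot, ← e.map_top]
      exact e.injective.ne (by decide)
    simp only [F, Option.elim, Prod.map_apply, map_bot, map_top]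
    exact mem_of_genTS_eq hT hS hne ⟨bot_le, fun _ => Or.inl rfl⟩
      (fun L _ hL => hL.2 rfl) (fun A B _ h => absurd h not_top_lt)
  · have hcov : ({i} : Finset (Fin 3)) ≠ ⊥ ∧ {i, pairSnd i c} ≠ (⊤ : Finset (Fin 3)) ∧
        ({i} : Finset (Fin 3)) ≠ {i, pairSnd i c} ∧ ({i} : Finset (Fin 3)) ≤ {i, pairSnd i c} ∧
        (∀ s : Finset (Fin 3), {i} ≤ s → s ≤ {i, pairSnd i c} →
          s = {i} ∨ s = {i, pairSnd i c}) ∧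
        (∀ s : Finset (Fin 3), {i, pairSnd i c} < s → s = ⊤) := by
      revert i c; decide
    obtain ⟨hbot, htop, hne, hle, hbetween, habove⟩ := hcov
    simp only [F, Option.elim, Prod.map_apply]
    refine mem_of_genTS_eq hT hS (e.injective.ne hne)
      ⟨e.monotone hle, fun h => absurd ((map_eq_top_iff e).1 h) htop⟩ ?_ ?_
    · rintro L ⟨h₁, -⟩ ⟨h₂, -⟩
      obtain ⟨s, rfl⟩ := e.surjective L
      exact (hbetween s (e.le_iff_le.1 h₁) (e.le_iff_le.1 h₂)).imp (congrArg e) (congrArg e)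
    · rintro A B ⟨-, hAB⟩ hlt
      obtain ⟨s, rfl⟩ := e.surjective B
      rcases hAB ((map_eq_top_iff e).2 (habove s (e.lt_iff_lt.1 hlt))) with rfl | rfl
      · rw [bot_inf_eq]
        exact fun h => hbot ((map_eq_bot_iff e).1 h.symm)
      · rw [top_inf_eq]
        exact fun h => hne (e.injective h.symm)

theorem complexity_eq_seven [Finite G] (e : Finset (Fin 3) ≃o Subgroup G) :
    complexity G = 7 := by
  refine IsGreatest.csSup_eq ⟨⟨nearlyCompleteTS G, isTransferSystem_nearlyCompleteTS,
    (minGenSize_le_seven e isTransferSystem_nearlyCompleteTS).antisymm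
      (seven_le_minGenSize_nearlyCompleteTS e)⟩, ?_⟩
  rintro n ⟨T, hT, rfl⟩
  exact minGenSize_le_seven e hT

/-- A group whose subgroup lattice is the Boolean lattice of rank `n` has width `n`. -/
theorem width_eq_card [Finite G] {ι : Type*} [Fintype ι] [DecidableEq ι]
    (e : Finset ι ≃o Subgroup G) : width G = Fintype.card ι := by
  let S₀ : Set (Subgroup G × Subgroup G) := Set.range fun i : ι => (e {i}ᶜ, ⊤)
  have hcoatom : ∀ i, IsCoatom (e {i}ᶜ) := fun i =>
    (e.isCoatom_iff _).2 (isAtom_compl.1 (by simp))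
  have hlt : ∀ p ∈ S₀, p.1 < p.2 := by
    rintro _ ⟨i, rfl⟩
    exact (hcoatom i).lt_top
  have hcard : S₀.ncard = Fintype.card ι := by
    rw [show S₀ = _ from Set.image_univ.symm, Set.ncard_image_of_injective, Set.ncard_univ,
      Nat.card_eq_fintype_card]
    intro i j hij
    simpa using hij
  have hgen : genTS S₀ = {p : Subgroup G × Subgroup G | p.1 ≤ p.2} := by
    refine genTS_eq_of_forall isTransferSystem_le (fun p hp => (hlt p hp).le) ?_
    rintro U hU hSU ⟨H, K⟩ (hHK : H ≤ K)
    have hU' := isTransferSystem_iff.1 hU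
    have htop : ∀ s : Finset ι, (e sᶜ, ⊤) ∈ U := by
      intro s
      induction s using Finset.induction_on with
      | empty => simpa [← top_eq_univ] using hU'.refl ⊤
      | insert i s _ ih =>
        have h : e (insert i s)ᶜ = e {i}ᶜ ⊓ e sᶜ := by
          rw [← map_inf]
          congr 1
          ext
          simp
        rw [h]
        exact hU'.trans (hU'.restrict (hSU ⟨i, rfl⟩) le_top) ih
    have hH := htop (e.symm H)ᶜ
    rw [compl_compl, e.apply_symm_apply] at hH
    simpa only [inf_eq_left.2 hHK] using hU'.restrict hH (le_top (a := K))
  refine le_antisymm (hcard ▸ minGenSize_le_ncard hlt hgen) (hcard ▸ card_le_minGenSize hlt hgen ?_)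
  rintro S hS _ ⟨i, rfl⟩
  exact mem_of_genTS_eq isTransferSystem_le hS (hcoatom i).1
    (Set.mem_ofPred.2 le_top)
    (fun L h _ => ((hcoatom i).le_iff.1 h).symm) (fun A B _ h => absurd h not_top_lt)

end BooleanSubgroupLattice

/-- For distinct primes `p, q, r`, the cyclic group `C_{pqr}` has complexity `7`
and width `3`. -/
theorem complexity_and_width_cyclic_pqr (p q r : ℕ) (hp : p.Prime) (hq : q.Prime)
    (hr : r.Prime) (hpq : p ≠ q) (hpr : p ≠ r) (hqr : q ≠ r) :
    complexity (Multiplicative (ZMod (p * q * r))) = 7 ∧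
    width (Multiplicative (ZMod (p * q * r))) = 3 := by
  have hπ : ∀ i, ((![p, q, r] : Fin 3 → ℕ) i).Prime := by
    simp [Fin.forall_fin_succ, hp, hq, hr]
  have hinj : Function.Injective (![p, q, r] : Fin 3 → ℕ) := by
    intro i j
    fin_cases i <;> fin_cases j <;> simp [hpq, hpr, hqr, hpq.symm, hpr.symm, hqr.symm]
  have : NeZero (p * q * r) :=
    ⟨mul_ne_zero (mul_ne_zero hp.ne_zero hq.ne_zero) hr.ne_zero⟩
  have : Finite (Multiplicative (ZMod (p * q * r))) :=
    inferInstanceAs (Finite (ZMod (p * q * r)))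
  obtain ⟨e⟩ := exists_orderIso_subgroup (G := Multiplicative (ZMod (p * q * r))) hπ hinj
    (by simp [Nat.card_congr Multiplicative.toAdd, Fin.prod_univ_succ, mul_assoc])
  exact ⟨complexity_eq_seven e, by simpa using width_eq_card e⟩
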